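/- arXiv:2107.07252 — 2 statements merged into one kernel-verified Lean document; each statement's English description precedes it below -/
import Mathlib

section
/- Fix γ ∈ [−4, 0) and a measurable β : (0, π/2] → [0, ∞) with ∫₀^{π/2} θ² β(θ) dθ = 8/π, and for ε ∈ (0, 1] set β^ε(θ) = (π³/ε³) β(πθ/ε) for θ ∈ (0, ε/2]. Let f : ℝ³ → [0, ∞) be bounded, measurable and compactly supported, and let ψ ∈ C_c^∞(ℝ³; ℝ). Then, as ε ↓ 0, (1/2) ∫∫_{ℝ⁶} f(v) f(v∗) |v−v∗|^γ ∫₀^{ε/2} β^ε(θ) ∫₀^{2π} ∇̄ψ(v, v∗, σ(θ,φ)) dφ dθ dv∗ dv converges to (1/2) ∫∫_{ℝ⁶} f(v) f(v∗) (div_v − div_{v∗})[ |v−v∗|^{2+γ} Π[v−v∗](∇ψ(v) − ∇ψ(v∗)) ] dv∗ dv; that is, the Boltzmann collision operator tested against ψ converges to the Landau collision operator tested against ψ. -/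
noncomputable section
open Real MeasureTheory Filter Topology
open scoped RealInnerProductSpace

abbrev E3 : Type := EuclideanSpace ℝ (Fin 3)

/-- Post-collision velocity `v' = (v+v∗)/2 + (|v−v∗|/2)σ`. -/
def vPost (v w σ : E3) : E3 := ((2 : ℝ)⁻¹) • (v + w) + (‖v - w‖ / 2) • σ

/-- Post-collision velocity `v∗' = (v+v∗)/2 − (|v−v∗|/2)σ`. -/
def vPostStar (v w σ : E3) : E3 := ((2 : ℝ)⁻¹) • (v + w) - (‖v - w‖ / 2) • σ

/-- Collision direction `σ(θ,φ) = cos θ·k + sin θ·(cos φ·h + sin φ·i)`. -/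
def sigmaDir (k h i : E3) (θ φ : ℝ) : E3 :=
  Real.cos θ • k + Real.sin θ • (Real.cos φ • h + Real.sin φ • i)

/-- Unit vector `k = (v − v∗)/|v − v∗|`. -/
def unitK (v w : E3) : E3 := ‖v - w‖⁻¹ • (v - w)

/-- Orthogonal projection `Π[z]u = u − ⟨z,u⟩z/|z|²` onto the plane orthogonal to `z`. -/
def projPerp (z u : E3) : E3 := u - ((‖z‖ ^ 2)⁻¹ * ⟪z, u⟫) • z

/-- `(div_v − div_{v∗}) F` for a vector field `F : ℝ³ × ℝ³ → ℝ³`. -/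
def divDiff (F : E3 × E3 → E3) (v w : E3) : ℝ :=
  LinearMap.trace ℝ E3 ((fderiv ℝ (fun z => F (z, w)) v : E3 →L[ℝ] E3) : E3 →ₗ[ℝ] E3)
    - LinearMap.trace ℝ E3 ((fderiv ℝ (fun z => F (v, z)) w : E3 →L[ℝ] E3) : E3 →ₗ[ℝ] E3)

theorem exists_norm_iteratedFDeriv_le {E : Type*} [NormedAddCommGroup E] [NormedSpace ℝ E]
    {ψ : E → ℝ} (hψ : ContDiff ℝ (⊤ : ℕ∞) ψ) (hψc : HasCompactSupport ψ) (n : ℕ) :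
    ∃ C : ℝ, 0 ≤ C ∧ ∀ x, ‖iteratedFDeriv ℝ n ψ x‖ ≤ C := by
  obtain ⟨C, hC⟩ := (hψ.continuous_iteratedFDeriv (m := n)
    (by exact_mod_cast le_top)).bounded_above_of_compact_support (hψc.iteratedFDeriv n)
  exact ⟨C, (norm_nonneg _).trans (hC 0), hC⟩

/-- Second-order Taylor expansion of a test function with a uniform cubic remainder. -/
theorem exists_taylor_two_bound {E : Type*} [NormedAddCommGroup E] [NormedSpace ℝ E]
    {ψ : E → ℝ} (hψ : ContDiff ℝ (⊤ : ℕ∞) ψ)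
    (hψc : HasCompactSupport ψ) :
    ∃ C : ℝ, 0 ≤ C ∧ ∀ v d : E,
      |ψ (v + d) - ψ v - fderiv ℝ ψ v d - 2⁻¹ * fderiv ℝ (fderiv ℝ ψ) v d d| ≤ C * ‖d‖ ^ 3 := by
  have h1 : ContDiff ℝ (⊤ : ℕ∞) (fderiv ℝ ψ) := hψ.fderiv_right (by simp)
  have h2 : ContDiff ℝ (⊤ : ℕ∞) (fderiv ℝ (fderiv ℝ ψ)) := h1.fderiv_right (by simp)
  have hd0 : ∀ x, HasFDerivAt ψ (fderiv ℝ ψ x) x := fun x =>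
    (hψ.differentiable (by simp) x).hasFDerivAt
  have hd1 : ∀ x, HasFDerivAt (fderiv ℝ ψ) (fderiv ℝ (fderiv ℝ ψ) x) x := fun x =>
    (h1.differentiable (by simp) x).hasFDerivAt
  obtain ⟨C, hC0, hC⟩ := exists_norm_iteratedFDeriv_le hψ hψc 3
  have hlip : ∀ x y, ‖fderiv ℝ (fderiv ℝ ψ) x - fderiv ℝ (fderiv ℝ ψ) y‖ ≤ C * ‖x - y‖ := by
    intro x y
    refine convex_univ.norm_image_sub_le_of_norm_fderiv_le (𝕜 := ℝ)
      (fun z _ => h2.differentiable (by simp) z) (fun z _ => ?_) (Set.mem_univ y) (Set.mem_univ x)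
    rw [← norm_iteratedFDeriv_one, norm_iteratedFDeriv_fderiv, norm_iteratedFDeriv_fderiv]
    exact hC z
  refine ⟨C, hC0, fun v d => ?_⟩
  have hsymm : ∀ a b, fderiv ℝ (fderiv ℝ ψ) v a b = fderiv ℝ (fderiv ℝ ψ) v b a :=
    fun a b => second_derivative_symmetric hd0 (hd1 v) a b
  have hv : v ∈ Metric.closedBall v ‖d‖ := by simp
  have hvd : v + d ∈ Metric.closedBall v ‖d‖ := by simp
  have step1 : ∀ x ∈ Metric.closedBall v ‖d‖,
      ‖fderiv ℝ ψ x - fderiv ℝ ψ v - fderiv ℝ (fderiv ℝ ψ) v (x - v)‖ ≤ C * ‖d‖ ^ 2 := by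
    intro x hx
    have hxv : ‖x - v‖ ≤ ‖d‖ := by simpa [dist_eq_norm] using hx
    have := (convex_closedBall v ‖d‖).norm_image_sub_le_of_norm_hasFDerivWithin_le' (𝕜 := ℝ)
      (f := fderiv ℝ ψ) (f' := fderiv ℝ (fderiv ℝ ψ)) (φ := fderiv ℝ (fderiv ℝ ψ) v)
      (C := C * ‖d‖) (fun y _ => (hd1 y).hasFDerivWithinAt) (fun y hy => by
        have hyv : ‖y - v‖ ≤ ‖d‖ := by simpa [dist_eq_norm] using hy
        exact (hlip y v).trans (by gcongr)) hv hx
    refine this.trans ?_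
    rw [pow_two, ← mul_assoc]
    gcongr
  have hg : ∀ x, HasFDerivAt
      (fun x => ψ x - fderiv ℝ ψ v (x - v) - 2⁻¹ * fderiv ℝ (fderiv ℝ ψ) v (x - v) (x - v))
      (fderiv ℝ ψ x - fderiv ℝ ψ v - fderiv ℝ (fderiv ℝ ψ) v (x - v)) x := by
    intro x
    have hs : HasFDerivAt (fun x : E => x - v) (ContinuousLinearMap.id ℝ E) x :=
      (hasFDerivAt_id x).sub_const v
    have ha := (fderiv ℝ ψ v).hasFDerivAt.comp x hs
    have hb := ((fderiv ℝ (fderiv ℝ ψ) v).hasFDerivAt.comp x hs).clm_apply hs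
    refine (((hd0 x).sub ha).sub (hb.const_mul 2⁻¹)).congr_fderiv ?_
    ext u
    simp [hsymm u]
    ring
  have := (convex_closedBall v ‖d‖).norm_image_sub_le_of_norm_hasFDerivWithin_le (𝕜 := ℝ)
    (fun y _ => (hg y).hasFDerivWithinAt) step1 hv hvd
  simp only [add_sub_cancel_left, sub_self, map_zero, Real.norm_eq_abs] at this
  refine le_of_eq_of_le ?_ (this.trans (le_of_eq (by ring)))
  congr 1
  simp
  ring

theorem integral_trig_quadratic (a b c d e g : ℝ) :
    ∫ φ in Set.Ioc (0 : ℝ) (2 * π),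
      (a + b * cos φ + c * sin φ + d * cos φ ^ 2 + e * (sin φ * cos φ) + g * sin φ ^ 2)
      = 2 * π * a + π * d + π * g := by
  rw [← intervalIntegral.integral_of_le (by positivity)]
  rw [intervalIntegral.integral_add, intervalIntegral.integral_add, intervalIntegral.integral_add,
    intervalIntegral.integral_add, intervalIntegral.integral_add]
  · simp only [intervalIntegral.integral_const_mul, integral_cos, integral_sin, integral_cos_sq,
      integral_sin_sq, integral_sin_mul_cos₁, intervalIntegral.integral_const, smul_eq_mul]
    simp
    ring
  all_goals exact (by fun_prop : Continuous _).intervalIntegrable _ _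

/-- The deviation integrated over the azimuthal angle, up to a cubic error in the deviation
angle. -/
theorem exists_angular_average_bound {ψ : E3 → ℝ} (hψ : ContDiff ℝ (⊤ : ℕ∞) ψ)
    (hψc : HasCompactSupport ψ) :
    ∃ C : ℝ, 0 ≤ C ∧ ∀ v w k h i : E3, ‖k‖ = 1 → ‖h‖ = 1 → ‖i‖ = 1 → v - w = ‖v - w‖ • k →
      ∀ θ : ℝ, |θ| ≤ 1 →
      |(∫ φ in Set.Ioc (0 : ℝ) (2 * π),
          (ψ (vPost v w (sigmaDir k h i θ φ)) + ψ (vPostStar v w (sigmaDir k h i θ φ))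
            - ψ v - ψ w))
        - (π * ‖v - w‖ * (cos θ - 1) * (fderiv ℝ ψ v k - fderiv ℝ ψ w k)
          + π * ‖v - w‖ ^ 2 / 8 * (2 * (cos θ - 1) ^ 2 *
              (fderiv ℝ (fderiv ℝ ψ) v k k + fderiv ℝ (fderiv ℝ ψ) w k k)
            + sin θ ^ 2 * (fderiv ℝ (fderiv ℝ ψ) v h h + fderiv ℝ (fderiv ℝ ψ) w h h
              + (fderiv ℝ (fderiv ℝ ψ) v i i + fderiv ℝ (fderiv ℝ ψ) w i i))))|
        ≤ C * ‖v - w‖ ^ 3 * |θ| ^ 3 := by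
  obtain ⟨C, hC0, hC⟩ := exists_taylor_two_bound hψ hψc
  refine ⟨2 * π * (2 * C * (3 / 2) ^ 3), by positivity, ?_⟩
  intro v w k h i hk hh hi hvw θ hθ
  set r := ‖v - w‖ with hr
  set P := fderiv ℝ ψ
  set H := fderiv ℝ P
  set δ : ℝ → E3 := fun φ =>
    (r / 2) • ((cos θ - 1) • k + sin θ • (cos φ • h + sin φ • i)) with hδ
  have hpost : ∀ φ, vPost v w (sigmaDir k h i θ φ) = v + δ φ := by
    intro φ
    have hw : w = v - r • k := by rw [← hvw]; abel
    simp only [vPost, sigmaDir, hδ, ← hr]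
    rw [hw]
    module
  have hpostS : ∀ φ, vPostStar v w (sigmaDir k h i θ φ) = w + -δ φ := by
    intro φ
    have hw : w = v - r • k := by rw [← hvw]; abel
    simp only [vPostStar, sigmaDir, hδ, ← hr]
    rw [hw]
    module
  have hr0 : 0 ≤ r := norm_nonneg _
  have hcos : |cos θ - 1| ≤ |θ| := by
    have h1 := Real.one_sub_sq_div_two_le_cos (x := θ)
    rw [abs_of_nonpos (by linarith [Real.cos_le_one θ])]
    nlinarith [sq_abs θ, abs_nonneg θ]
  have hδn : ∀ φ, ‖δ φ‖ ≤ 3 / 2 * r * |θ| := by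
    intro φ
    have hA : ‖cos φ • h + sin φ • i‖ ≤ 2 := by
      refine (norm_add_le _ _).trans ?_
      rw [norm_smul, norm_smul, hh, hi, Real.norm_eq_abs, Real.norm_eq_abs]
      linarith [Real.abs_cos_le_one φ, Real.abs_sin_le_one φ]
    have hB : ‖(cos θ - 1) • k + sin θ • (cos φ • h + sin φ • i)‖ ≤ 3 * |θ| := by
      refine (norm_add_le _ _).trans ?_
      rw [norm_smul, norm_smul, hk, Real.norm_eq_abs, Real.norm_eq_abs]
      have := mul_le_mul (Real.abs_sin_le_abs (x := θ)) hA (norm_nonneg _) (abs_nonneg _)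
      linarith
    rw [hδ, norm_smul, Real.norm_eq_abs, abs_of_nonneg (by positivity)]
    nlinarith
  set main : ℝ → ℝ := fun φ => P v (δ φ) - P w (δ φ) + 2⁻¹ * (H v (δ φ) (δ φ) + H w (δ φ) (δ φ))
    with hmain
  have hδc : Continuous δ := by fun_prop
  have hψcont : Continuous ψ := hψ.continuous
  have hmainI : ∫ φ in Set.Ioc (0 : ℝ) (2 * π), main φ =
      π * r * (cos θ - 1) * (P v k - P w k)
          + π * r ^ 2 / 8 * (2 * (cos θ - 1) ^ 2 * (H v k k + H w k k)
            + sin θ ^ 2 * (H v h h + H w h h + (H v i i + H w i i))) := by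
    set s := cos θ - 1
    set t := sin θ
    have : main = fun φ =>
        (r / 2 * s * (P v k - P w k) + r ^ 2 / 8 * s ^ 2 * (H v k k + H w k k))
        + (r / 2 * t * (P v h - P w h)
            + r ^ 2 / 8 * s * t * (H v k h + H w k h + H v h k + H w h k)) * cos φ
        + (r / 2 * t * (P v i - P w i)
            + r ^ 2 / 8 * s * t * (H v k i + H w k i + H v i k + H w i k)) * sin φ
        + (r ^ 2 / 8 * t ^ 2 * (H v h h + H w h h)) * cos φ ^ 2
        + (r ^ 2 / 8 * t ^ 2 * (H v h i + H w h i + H v i h + H w i h)) * (sin φ * cos φ)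
        + (r ^ 2 / 8 * t ^ 2 * (H v i i + H w i i)) * sin φ ^ 2 := by
      funext φ
      simp only [hmain, hδ, map_add, map_smul, add_apply,
        smul_apply, smul_eq_mul]
      ring
    rw [this, integral_trig_quadratic]
    ring
  have hcont1 : Continuous fun φ => ψ (v + δ φ) + ψ (w + -δ φ) - ψ v - ψ w := by fun_prop
  have hcont2 : Continuous main := by fun_prop
  rw [← hmainI]
  simp only [hpost, hpostS]
  rw [← integral_sub (hcont1.integrableOn_Ioc) (hcont2.integrableOn_Ioc)]
  have hbd := norm_setIntegral_le_of_norm_le_const (μ := volume) (s := Set.Ioc (0 : ℝ) (2 * π))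
    (f := fun φ => ψ (v + δ φ) + ψ (w + -δ φ) - ψ v - ψ w - main φ)
    (C := 2 * C * (3 / 2) ^ 3 * r ^ 3 * |θ| ^ 3) measure_Ioc_lt_top (by
      intro φ _
      have e1 := hC v (δ φ)
      have e2 := hC w (-δ φ)
      have e3 : ‖δ φ‖ ^ 3 ≤ (3 / 2 * r * |θ|) ^ 3 := by gcongr; exact hδn φ
      have e4 : C * ‖δ φ‖ ^ 3 ≤ C * (3 / 2 * r * |θ|) ^ 3 := by gcongr
      rw [norm_neg] at e2
      simp only [map_neg, neg_apply, neg_neg] at e2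
      rw [Real.norm_eq_abs]
      rw [abs_le] at e1 e2 ⊢
      simp only [hmain]
      constructor <;> nlinarith)
  rw [Real.norm_eq_abs] at hbd
  refine hbd.trans (le_of_eq ?_)
  simp [Measure.real, Real.volume_Ioc, Real.pi_pos.le]
  ring

theorem scaled_angular_integral_eq (β g : ℝ → ℝ) {ε : ℝ} (hε : 0 < ε) :
    ∫ θ in Set.Ioc (0 : ℝ) (ε / 2), (π ^ 3 / ε ^ 3) * β (π * θ / ε) * g θ
      = ∫ χ in Set.Ioc (0 : ℝ) (π / 2), π ^ 2 / ε ^ 2 * β χ * g (ε / π * χ) := by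
  have hπ := Real.pi_pos
  rw [← intervalIntegral.integral_of_le (by positivity),
    ← intervalIntegral.integral_of_le (by positivity)]
  have := intervalIntegral.integral_comp_mul_left (a := 0) (b := ε / 2) (c := π / ε)
    (fun χ => π ^ 3 / ε ^ 3 * β χ * g (ε / π * χ)) (by positivity)
  have e1 : ∀ θ : ℝ, ε / π * (π / ε * θ) = θ := fun θ => by field_simp
  have e2 : π / ε * (ε / 2) = π / 2 := by field_simp
  have e3 : ∀ θ : ℝ, π * θ / ε = π / ε * θ := fun θ => by ring
  simp only [e1, e2, mul_zero] at this
  simp only [e3]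
  rw [this, ← intervalIntegral.integral_smul]
  congr 1
  funext χ
  simp only [smul_eq_mul]
  field_simp

theorem norm_scaled_angular_integrand_le {β g : ℝ → ℝ} (hβ0 : ∀ θ, 0 ≤ β θ) {C : ℝ}
    (hg : ∀ θ, 0 < θ → θ ≤ 1 → |g θ| ≤ C * θ ^ 2) {ε χ : ℝ} (hε : 0 < ε) (hε1 : ε ≤ 1)
    (hχ : χ ∈ Set.Ioc (0 : ℝ) (π / 2)) :
    ‖π ^ 2 / ε ^ 2 * β χ * g (ε / π * χ)‖ ≤ C * (χ ^ 2 * β χ) := by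
  have hπ := Real.pi_pos
  have hχ0 := hχ.1
  have hle : ε / π * χ ≤ 1 := by
    have : ε / π * χ ≤ ε / π * (π / 2) := by gcongr; exact hχ.2
    have e : ε / π * (π / 2) = ε / 2 := by field_simp
    linarith
  have h1 := hg (ε / π * χ) (by positivity) hle
  have h2 : 0 ≤ π ^ 2 / ε ^ 2 * β χ := mul_nonneg (by positivity) (hβ0 χ)
  rw [norm_mul, Real.norm_eq_abs, Real.norm_eq_abs, abs_of_nonneg h2]
  calc _ ≤ π ^ 2 / ε ^ 2 * β χ * (C * (ε / π * χ) ^ 2) := by gcongr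
    _ = _ := by field_simp

theorem abs_scaled_angular_integral_le {β g : ℝ → ℝ} (hβ0 : ∀ θ, 0 ≤ β θ)
    (hβi : IntegrableOn (fun θ => θ ^ 2 * β θ) (Set.Ioc (0 : ℝ) (π / 2))) {C : ℝ}
    (hg : ∀ θ, 0 < θ → θ ≤ 1 → |g θ| ≤ C * θ ^ 2) {ε : ℝ} (hε : 0 < ε) (hε1 : ε ≤ 1) :
    |∫ θ in Set.Ioc (0 : ℝ) (ε / 2), (π ^ 3 / ε ^ 3) * β (π * θ / ε) * g θ|
      ≤ C * ∫ θ in Set.Ioc (0 : ℝ) (π / 2), θ ^ 2 * β θ := by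
  rw [scaled_angular_integral_eq β g hε, ← Real.norm_eq_abs, ← integral_const_mul]
  refine norm_integral_le_of_norm_le (hβi.const_mul C) ?_
  filter_upwards [ae_restrict_mem measurableSet_Ioc] with χ hχ
  exact norm_scaled_angular_integrand_le hβ0 hg hε hε1 hχ

/-- Concentration of the rescaled angular kernel at grazing deviation angles. -/
theorem tendsto_scaled_angular_integral {β g : ℝ → ℝ} (hβm : Measurable β) (hβ0 : ∀ θ, 0 ≤ β θ)
    (hβi : IntegrableOn (fun θ => θ ^ 2 * β θ) (Set.Ioc (0 : ℝ) (π / 2)))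
    (hgm : Measurable g) {C L : ℝ} (hg : ∀ θ, 0 < θ → θ ≤ 1 → |g θ| ≤ C * θ ^ 2)
    (hL : Tendsto (fun θ => g θ / θ ^ 2) (𝓝[>] 0) (𝓝 L)) :
    Tendsto (fun ε : ℝ =>
        ∫ θ in Set.Ioc (0 : ℝ) (ε / 2), (π ^ 3 / ε ^ 3) * β (π * θ / ε) * g θ)
      (𝓝[>] 0) (𝓝 (L * ∫ θ in Set.Ioc (0 : ℝ) (π / 2), θ ^ 2 * β θ)) := by
  have hπ := Real.pi_pos
  have hev : ∀ᶠ ε : ℝ in 𝓝[>] 0, 0 < ε ∧ ε ≤ 1 := by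
    filter_upwards [Ioc_mem_nhdsGT (zero_lt_one (α := ℝ))] with ε hε using hε
  rw [← integral_const_mul]
  refine Tendsto.congr' (f₁ := fun ε : ℝ => ∫ χ in Set.Ioc (0 : ℝ) (π / 2),
    π ^ 2 / ε ^ 2 * β χ * g (ε / π * χ)) ?_ ?_
  · filter_upwards [hev] with ε hε
    exact (scaled_angular_integral_eq β g hε.1).symm
  refine tendsto_integral_filter_of_dominated_convergence (fun χ => C * (χ ^ 2 * β χ)) ?_ ?_
    (hβi.const_mul C) ?_
  · refine Eventually.of_forall fun ε => Measurable.aestronglyMeasurable ?_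
    fun_prop
  · filter_upwards [hev] with ε hε
    filter_upwards [ae_restrict_mem measurableSet_Ioc] with χ hχ
    exact norm_scaled_angular_integrand_le hβ0 hg hε.1 hε.2 hχ
  · filter_upwards [ae_restrict_mem measurableSet_Ioc] with χ hχ
    have hχ0 := hχ.1
    have ht : Tendsto (fun ε : ℝ => ε / π * χ) (𝓝[>] 0) (𝓝[>] 0) := by
      refine tendsto_nhdsWithin_iff.2 ⟨?_, ?_⟩
      · have : Continuous fun ε : ℝ => ε / π * χ := by fun_prop
        simpa using (this.tendsto 0).mono_left nhdsWithin_le_nhds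
      · filter_upwards [hev] with ε hε
        have := hε.1
        exact Set.mem_Ioi.2 (by positivity)
    refine ((hL.comp ht).mul_const (χ ^ 2 * β χ)).congr' ?_
    filter_upwards [hev] with ε hε
    have := hε.1
    simp only [Function.comp]
    field_simp

theorem ae_fst_ne_snd : ∀ᵐ q : E3 × E3, q.1 ≠ q.2 := by
  have h := Measure.addHaar_submodule ((volume : Measure E3).prod volume)
    (LinearMap.eqLocus (LinearMap.fst ℝ E3 E3) (LinearMap.snd ℝ E3 E3)) (by
      intro htop
      have : ((EuclideanSpace.single 0 1 : E3), (0 : E3)) ∈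
          LinearMap.eqLocus (LinearMap.fst ℝ E3 E3) (LinearMap.snd ℝ E3 E3) := by
        rw [htop]; trivial
      simp at this)
  have hset : {q : E3 × E3 | ¬ q.1 ≠ q.2} =
      LinearMap.eqLocus (LinearMap.fst ℝ E3 E3) (LinearMap.snd ℝ E3 E3) := by
    ext q
    simp
  rw [ae_iff, hset]
  exact h

theorem integrableOn_norm_rpow_ball {s : ℝ} (hs : -3 < s) (R : ℝ) :
    IntegrableOn (fun x : E3 => ‖x‖ ^ s) (Metric.ball 0 R) := by
  rcases le_or_gt R 0 with hR | hR
  · rw [Metric.ball_eq_empty.2 hR]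
    exact integrableOn_empty
  rw [integrableOn_fun_norm_addHaar (μ := (volume : Measure E3)) (f := fun r : ℝ => r ^ s)]
  have h : IntegrableOn (fun y : ℝ => y ^ (s + 2)) (Set.Ioo 0 R) :=
    (intervalIntegral.integrableOn_Ioo_rpow_iff hR).2 (by linarith)
  refine h.congr_fun (fun y hy => ?_) measurableSet_Ioo
  simp only [finrank_euclideanSpace, Fintype.card_fin, smul_eq_mul]
  rw [Real.rpow_add hy.1, mul_comm]
  norm_num

theorem integrable_indicator_mul_norm_sub_rpow {s : ℝ} (hs : -3 < s) (R R' : ℝ) :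
    Integrable (fun q : E3 × E3 => (Metric.ball (0 : E3) R).indicator (fun _ => (1 : ℝ)) q.2 *
      (Metric.ball (0 : E3) R').indicator (fun x => ‖x‖ ^ s) (q.1 - q.2)) := by
  refine Integrable.convolution_integrand (ContinuousLinearMap.mul ℝ ℝ) ?_ ?_
  · rw [integrable_indicator_iff measurableSet_ball]
    exact integrableOn_const (by finiteness)
  · rw [integrable_indicator_iff measurableSet_ball]
    exact integrableOn_norm_rpow_ball hs R'

theorem hasFDerivAt_norm_sub_rpow (s : ℝ) {v w : E3} (hvw : v ≠ w) :
    HasFDerivAt (fun z : E3 => ‖z - w‖ ^ s)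
      ((s * ‖v - w‖ ^ (s - 2)) • innerSL ℝ (v - w)) v := by
  have hy : 0 < ‖v - w‖ := norm_pos_iff.2 (sub_ne_zero.2 hvw)
  have hs : HasFDerivAt (fun x : E3 => x - w) (ContinuousLinearMap.id ℝ E3) v :=
    (hasFDerivAt_id v).sub_const w
  have h := hs.norm_sq.rpow_const (p := s / 2) (Or.inl (by positivity))
  have hp : ∀ x : E3, ∀ t : ℝ, (‖x‖ ^ 2) ^ (t / 2) = ‖x‖ ^ t := by
    intro x t
    rw [← Real.rpow_natCast, ← Real.rpow_mul (norm_nonneg _)]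
    congr 1
    push_cast
    ring
  have e : s / 2 - 1 = (s - 2) / 2 := by ring
  simp only [hp, e] at h
  refine h.congr_fderiv ?_
  ext u
  simp
  ring

/-- Divergence of the weighted projected field `|z|^{2+γ} Π[z] U` in the relative velocity. -/
theorem trace_fderiv_norm_rpow_smul_projPerp (γ : ℝ) {v w : E3} (hvw : v ≠ w) {U : E3 → E3}
    {M : E3 →L[ℝ] E3} (hU : HasFDerivAt U M v) :
    LinearMap.trace ℝ E3 ((fderiv ℝ (fun z => (‖z - w‖ ^ (2 + γ)) • projPerp (z - w) (U z)) v :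
        E3 →L[ℝ] E3) : E3 →ₗ[ℝ] E3)
      = ‖v - w‖ ^ γ * (‖v - w‖ ^ 2 * LinearMap.trace ℝ E3 (M : E3 →ₗ[ℝ] E3)
          - ⟪v - w, M (v - w)⟫ - 2 * ⟪v - w, U v⟫) := by
  have hy : 0 < ‖v - w‖ := norm_pos_iff.2 (sub_ne_zero.2 hvw)
  have hs : HasFDerivAt (fun x : E3 => x - w) (ContinuousLinearMap.id ℝ E3) v :=
    (hasFDerivAt_id v).sub_const w
  have hcongr : (fun z => (‖z - w‖ ^ (2 + γ)) • projPerp (z - w) (U z)) =ᶠ[𝓝 v]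
      fun z => (‖z - w‖ ^ (2 + γ)) • U z - (‖z - w‖ ^ γ * ⟪z - w, U z⟫) • (z - w) := by
    filter_upwards [isOpen_ne.mem_nhds hvw] with z hz
    have hz : 0 < ‖z - w‖ := norm_pos_iff.2 (sub_ne_zero.2 hz)
    have e : ‖z - w‖ ^ (2 + γ) = ‖z - w‖ ^ γ * ‖z - w‖ ^ 2 := by
      rw [add_comm, Real.rpow_add hz]; norm_num
    rw [projPerp, smul_sub, smul_smul, e]
    congr 2
    field_simp
  have hF := ((hasFDerivAt_norm_sub_rpow (2 + γ) hvw).smul hU).sub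
    (((hasFDerivAt_norm_sub_rpow γ hvw).mul (hs.inner ℝ hU)).smul hs)
  rw [(hF.congr_of_eventuallyEq hcongr).fderiv]
  have e : ‖v - w‖ ^ (2 + γ) = ‖v - w‖ ^ γ * ‖v - w‖ ^ 2 := by
    rw [add_comm, Real.rpow_add hy]; norm_num
  have e' : ‖v - w‖ ^ (γ - 2) * ‖v - w‖ ^ 2 = ‖v - w‖ ^ γ := by
    rw [← Real.rpow_natCast, ← Real.rpow_add hy]; norm_num
  clear hF hcongr hs
  simp only [Pi.mul_apply]
  generalize v - w = y at *
  simp only [ContinuousLinearMap.toLinearMap_sub, ContinuousLinearMap.toLinearMap_add,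
    ContinuousLinearMap.toLinearMap_smul, map_sub, map_add, map_smul]
  simp [-map_sub]
  linear_combination LinearMap.trace ℝ E3 (M : E3 →ₗ[ℝ] E3) * e - ⟪y, U v⟫ * γ * e'

theorem hasFDerivAt_gradient {ψ : E3 → ℝ} (hψ : ContDiff ℝ (⊤ : ℕ∞) ψ) (x : E3) :
    ∃ M : E3 →L[ℝ] E3, HasFDerivAt (gradient ψ) M x ∧
      ∀ a b : E3, ⟪a, M b⟫ = fderiv ℝ (fderiv ℝ ψ) x b a := by
  have h1 : ContDiff ℝ (⊤ : ℕ∞) (fderiv ℝ ψ) := hψ.fderiv_right (by simp)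
  have hd1 : HasFDerivAt (fderiv ℝ ψ) (fderiv ℝ (fderiv ℝ ψ) x) x :=
    (h1.differentiable (by simp) x).hasFDerivAt
  let L : (E3 →L[ℝ] ℝ) →L[ℝ] E3 := LinearMap.toContinuousLinearMap
    { toFun := fun l => (InnerProductSpace.toDual ℝ E3).symm l
      map_add' := fun a b => map_add _ a b
      map_smul' := fun a b => by simp }
  have hL : ∀ (a : E3) (l : E3 →L[ℝ] ℝ), ⟪a, L l⟫ = l a := by
    intro a l
    rw [real_inner_comm]
    exact InnerProductSpace.toDual_symm_apply
  exact ⟨L.comp (fderiv ℝ (fderiv ℝ ψ) x), L.hasFDerivAt.comp x hd1, fun a b => hL a _⟩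

theorem inner_gradient (ψ : E3 → ℝ) (a x : E3) : ⟪a, gradient ψ x⟫ = fderiv ℝ ψ x a := by
  rw [real_inner_comm]
  exact InnerProductSpace.toDual_symm_apply

theorem projPerp_neg (z u : E3) : projPerp (-z) u = projPerp z u := by
  simp [projPerp]

theorem trace_eq_of_orthonormal {k h i : E3} (hk : ‖k‖ = 1) (hh : ‖h‖ = 1) (hi : ‖i‖ = 1)
    (hkh : ⟪k, h⟫ = 0) (hki : ⟪k, i⟫ = 0) (hhi : ⟪h, i⟫ = 0) (M : E3 →ₗ[ℝ] E3) :
    LinearMap.trace ℝ E3 M = ⟪k, M k⟫ + ⟪h, M h⟫ + ⟪i, M i⟫ := by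
  have hon : Orthonormal ℝ ![k, h, i] := by
    rw [orthonormal_iff_ite]
    intro a b
    fin_cases a <;> fin_cases b <;>
      simp [hk, hh, hi, hkh, hki, hhi, real_inner_comm k h, real_inner_comm k i,
        real_inner_comm h i]
  let b := basisOfOrthonormalOfCardEqFinrank hon (by simp)
  have hb : ⇑b = ![k, h, i] := coe_basisOfOrthonormalOfCardEqFinrank hon (by simp)
  let b' := b.toOrthonormalBasis (by rw [hb]; exact hon)
  have hb' : ⇑b' = ![k, h, i] := by simp [b', hb]
  rw [LinearMap.trace_eq_sum_inner M b', hb']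
  simp [Fin.sum_univ_three]

/-- The Landau side in terms of the first and second derivatives of the test function. -/
theorem divDiff_eq {ψ : E3 → ℝ} (hψ : ContDiff ℝ (⊤ : ℕ∞) ψ) (γ : ℝ) {v w k h i : E3}
    (hvw : v ≠ w) (hk : ‖k‖ = 1) (hh : ‖h‖ = 1) (hi : ‖i‖ = 1)
    (hkh : ⟪k, h⟫ = 0) (hki : ⟪k, i⟫ = 0) (hhi : ⟪h, i⟫ = 0) (hkvw : v - w = ‖v - w‖ • k) :
    divDiff (fun r : E3 × E3 => (‖r.1 - r.2‖ ^ (2 + γ)) •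
        projPerp (r.1 - r.2) (gradient ψ r.1 - gradient ψ r.2)) v w
      = ‖v - w‖ ^ γ * (‖v - w‖ ^ 2 *
          (fderiv ℝ (fderiv ℝ ψ) v h h + fderiv ℝ (fderiv ℝ ψ) w h h
            + (fderiv ℝ (fderiv ℝ ψ) v i i + fderiv ℝ (fderiv ℝ ψ) w i i))
          - 4 * (‖v - w‖ * (fderiv ℝ ψ v k - fderiv ℝ ψ w k))) := by
  obtain ⟨M, hM, hMin⟩ := hasFDerivAt_gradient hψ v
  obtain ⟨N, hN, hNin⟩ := hasFDerivAt_gradient hψ w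
  have h1 := trace_fderiv_norm_rpow_smul_projPerp γ hvw (hM.sub_const (gradient ψ w))
  have h2 := trace_fderiv_norm_rpow_smul_projPerp γ hvw.symm (hN.const_sub (gradient ψ v))
  have e2 : (fun z => ‖z - v‖ ^ (2 + γ) • projPerp (z - v) (gradient ψ v - gradient ψ z))
      = fun z => ‖v - z‖ ^ (2 + γ) • projPerp (v - z) (gradient ψ v - gradient ψ z) := by
    funext z
    rw [← neg_sub v z, norm_neg, projPerp_neg]
  rw [e2] at h2
  simp only [divDiff]
  rw [h1, h2, ← neg_sub v w, norm_neg]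
  have hG : ⟪v - w, gradient ψ v - gradient ψ w⟫ =
      ‖v - w‖ * (fderiv ℝ ψ v k - fderiv ℝ ψ w k) := by
    conv_lhs => rw [hkvw]
    rw [inner_smul_left, inner_sub_right, inner_gradient, inner_gradient]
    simp
  have hQ : ∀ T : E3 →L[ℝ] E3, ⟪v - w, T (v - w)⟫ = ‖v - w‖ ^ 2 * ⟪k, T k⟫ := by
    intro T
    conv_lhs => rw [hkvw]
    rw [map_smul, inner_smul_left, inner_smul_right]
    simp
    ring
  rw [map_neg, inner_neg_neg, inner_neg_left, hG, hQ, hQ,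
    trace_eq_of_orthonormal hk hh hi hkh hki hhi, trace_eq_of_orthonormal hk hh hi hkh hki hhi]
  simp [hMin, hNin]
  ring

/-- If `G` agrees with its second-order angular expansion up to a cubic error, then `G θ / θ ^ 2`
has the expected limit at `0`. -/
theorem tendsto_div_sq_of_expansion {G : ℝ → ℝ} {a b d K : ℝ}
    (hG : ∀ θ : ℝ, |θ| ≤ 1 →
      |G θ - (a * (cos θ - 1) + (b * (cos θ - 1) ^ 2 + d * sin θ ^ 2))| ≤ K * |θ| ^ 3) :
    Tendsto (fun θ => G θ / θ ^ 2) (𝓝[>] 0) (𝓝 (-a / 2 + d)) := by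
  have hid : Tendsto (fun θ : ℝ => θ) (𝓝[>] 0) (𝓝 0) := nhdsWithin_le_nhds
  have hsin : Tendsto (fun θ : ℝ => sin θ / θ) (𝓝[>] 0) (𝓝 1) := by
    have := (hasDerivAt_iff_tendsto_slope_zero.1 (Real.hasDerivAt_sin 0)).mono_left
      (nhdsGT_le_nhdsNE 0)
    simpa [div_eq_inv_mul] using this
  have hcos : Tendsto (fun θ : ℝ => cos θ) (𝓝[>] 0) (𝓝 1) := by
    simpa using (Real.continuous_cos.tendsto 0).mono_left nhdsWithin_le_nhds
  have hmain : Tendsto (fun θ : ℝ => -a * ((sin θ / θ) ^ 2 / (1 + cos θ))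
      + (b * (((sin θ / θ) ^ 2 / (1 + cos θ)) * (1 - cos θ)) + d * (sin θ / θ) ^ 2))
      (𝓝[>] 0) (𝓝 (-a * (1 ^ 2 / (1 + 1)) + (b * ((1 ^ 2 / (1 + 1)) * (1 - 1)) + d * 1 ^ 2))) := by
    have hq := (hsin.pow 2).div (hcos.const_add 1) (by norm_num)
    exact (hq.const_mul (-a)).add
      (((hq.mul (hcos.const_sub 1)).const_mul b).add ((hsin.pow 2).const_mul d))
  have hev : ∀ᶠ θ : ℝ in 𝓝[>] 0, 0 < θ ∧ θ ≤ 1 := by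
    filter_upwards [Ioc_mem_nhdsGT (zero_lt_one (α := ℝ))] with θ hθ using hθ
  have hcospos : ∀ θ : ℝ, 0 < θ → θ ≤ 1 → 0 < cos θ := fun θ h0 h1 =>
    Real.cos_pos_of_le_one (by rwa [abs_of_pos h0])
  have herr : Tendsto (fun θ : ℝ => G θ / θ ^ 2 - (-a * ((sin θ / θ) ^ 2 / (1 + cos θ))
      + (b * (((sin θ / θ) ^ 2 / (1 + cos θ)) * (1 - cos θ)) + d * (sin θ / θ) ^ 2)))
      (𝓝[>] 0) (𝓝 0) := by
    refine squeeze_zero_norm' ?_ (by simpa using hid.const_mul K)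
    filter_upwards [hev] with θ hθ
    have hθ0 := hθ.1
    have hc := hcospos θ hθ.1 hθ.2
    have key : (sin θ / θ) ^ 2 / (1 + cos θ) = (1 - cos θ) / θ ^ 2 := by
      rw [div_pow, Real.sin_sq]
      field_simp
      ring
    have h := hG θ (by rw [abs_of_pos hθ0]; exact hθ.2)
    rw [abs_of_pos hθ0] at h
    have e : G θ / θ ^ 2 - (-a * ((sin θ / θ) ^ 2 / (1 + cos θ))
        + (b * (((sin θ / θ) ^ 2 / (1 + cos θ)) * (1 - cos θ)) + d * (sin θ / θ) ^ 2))
        = (G θ - (a * (cos θ - 1) + (b * (cos θ - 1) ^ 2 + d * sin θ ^ 2))) / θ ^ 2 := by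
      rw [key]
      field_simp
      ring
    rw [e, Real.norm_eq_abs, abs_div, abs_of_pos (by positivity : 0 < θ ^ 2),
      div_le_iff₀ (by positivity)]
    exact h.trans (le_of_eq (by ring))
  convert hmain.add herr using 2
  · ring
  · ring

theorem abs_le_of_expansion {G : ℝ → ℝ} {a b d K : ℝ} (hK : 0 ≤ K)
    (hG : ∀ θ : ℝ, |θ| ≤ 1 →
      |G θ - (a * (cos θ - 1) + (b * (cos θ - 1) ^ 2 + d * sin θ ^ 2))| ≤ K * |θ| ^ 3)
    {θ : ℝ} (hθ0 : 0 < θ) (hθ1 : θ ≤ 1) :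
    |G θ| ≤ (|a| + |b| + |d| + K) * θ ^ 2 := by
  have h := hG θ (by rwa [abs_of_pos hθ0])
  rw [abs_of_pos hθ0] at h
  have hc : |cos θ - 1| ≤ θ ^ 2 := by
    rw [abs_le]
    constructor
    · nlinarith [Real.one_sub_sq_div_two_le_cos (x := θ)]
    · nlinarith [Real.cos_le_one θ]
  have hs : sin θ ^ 2 ≤ θ ^ 2 := by
    have := Real.sin_lt hθ0
    have h0 := Real.sin_nonneg_of_nonneg_of_le_pi hθ0.le (by linarith [Real.pi_gt_three])
    gcongr
  have hc2 : (cos θ - 1) ^ 2 ≤ θ ^ 2 := by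
    rw [← sq_abs]
    have : θ ^ 2 ≤ θ := by nlinarith
    have := hc.trans this
    gcongr
  have h3 : K * θ ^ 3 ≤ K * θ ^ 2 :=
    mul_le_mul_of_nonneg_left (pow_le_pow_of_le_one hθ0.le hθ1 (by norm_num)) hK
  have e1 : |a * (cos θ - 1)| ≤ |a| * θ ^ 2 := by
    rw [abs_mul]; gcongr
  have e2 : |b * (cos θ - 1) ^ 2| ≤ |b| * θ ^ 2 := by
    rw [abs_mul, abs_of_nonneg (sq_nonneg (cos θ - 1))]; gcongr
  have e3 : |d * sin θ ^ 2| ≤ |d| * θ ^ 2 := by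
    rw [abs_mul, abs_of_nonneg (sq_nonneg (sin θ))]; gcongr
  rw [abs_le] at *
  constructor <;> linarith [e1.1, e1.2, e2.1, e2.2, e3.1, e3.2, h.1, h.2]

/-- The collisional difference of `ψ`, integrated over the azimuthal angle. -/
def angularAverage (ψ : E3 → ℝ) (v w k h i : E3) (θ : ℝ) : ℝ :=
  ∫ φ in Set.Ioc (0 : ℝ) (2 * π),
    (ψ (vPost v w (sigmaDir k h i θ φ)) + ψ (vPostStar v w (sigmaDir k h i θ φ)) - ψ v - ψ w)

theorem exists_angularAverage_expansion {ψ : E3 → ℝ} (hψ : ContDiff ℝ (⊤ : ℕ∞) ψ)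
    (hψc : HasCompactSupport ψ) :
    ∃ C : ℝ, 0 ≤ C ∧ ∀ v w k h i : E3, ‖k‖ = 1 → ‖h‖ = 1 → ‖i‖ = 1 → v - w = ‖v - w‖ • k →
      ∀ θ : ℝ, |θ| ≤ 1 →
      |angularAverage ψ v w k h i θ
        - (π * ‖v - w‖ * (fderiv ℝ ψ v k - fderiv ℝ ψ w k) * (cos θ - 1)
          + (π * ‖v - w‖ ^ 2 / 4 *
              (fderiv ℝ (fderiv ℝ ψ) v k k + fderiv ℝ (fderiv ℝ ψ) w k k) * (cos θ - 1) ^ 2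
            + π * ‖v - w‖ ^ 2 / 8 * (fderiv ℝ (fderiv ℝ ψ) v h h + fderiv ℝ (fderiv ℝ ψ) w h h
              + (fderiv ℝ (fderiv ℝ ψ) v i i + fderiv ℝ (fderiv ℝ ψ) w i i)) * sin θ ^ 2))|
        ≤ C * ‖v - w‖ ^ 3 * |θ| ^ 3 := by
  obtain ⟨C, hC0, hC⟩ := exists_angular_average_bound hψ hψc
  refine ⟨C, hC0, fun v w k h i hk hh hi hvw θ hθ => ?_⟩
  refine le_of_eq_of_le ?_ (hC v w k h i hk hh hi hvw θ hθ)
  rw [angularAverage]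
  congr 2
  ring

/-- The azimuthal average is quadratically small both in the deviation angle and in the relative
velocity. -/
theorem exists_abs_angularAverage_le {ψ : E3 → ℝ} (hψ : ContDiff ℝ (⊤ : ℕ∞) ψ)
    (hψc : HasCompactSupport ψ) (R : ℝ) :
    ∃ C : ℝ, 0 ≤ C ∧ ∀ v w k h i : E3, ‖k‖ = 1 → ‖h‖ = 1 → ‖i‖ = 1 → v - w = ‖v - w‖ • k →
      ‖v - w‖ ≤ R → ∀ θ : ℝ, 0 < θ → θ ≤ 1 →
      |angularAverage ψ v w k h i θ| ≤ C * ‖v - w‖ ^ 2 * θ ^ 2 := by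
  obtain ⟨C, hC0, hC⟩ := exists_angularAverage_expansion hψ hψc
  obtain ⟨D, hD0, hD⟩ := exists_norm_iteratedFDeriv_le hψ hψc 2
  have h1 : ContDiff ℝ (⊤ : ℕ∞) (fderiv ℝ ψ) := hψ.fderiv_right (by simp)
  have hHn : ∀ x, ‖fderiv ℝ (fderiv ℝ ψ) x‖ ≤ D := by
    intro x
    rw [← norm_iteratedFDeriv_one, norm_iteratedFDeriv_fderiv]
    exact hD x
  have hP : ∀ v w k : E3, ‖k‖ = 1 → |fderiv ℝ ψ v k - fderiv ℝ ψ w k| ≤ D * ‖v - w‖ := by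
    intro v w k hk
    have hl : ‖fderiv ℝ ψ v - fderiv ℝ ψ w‖ ≤ D * ‖v - w‖ :=
      convex_univ.norm_image_sub_le_of_norm_fderiv_le (𝕜 := ℝ)
        (fun z _ => h1.differentiable (by simp) z) (fun z _ => hHn z)
        (Set.mem_univ w) (Set.mem_univ v)
    have := (fderiv ℝ ψ v - fderiv ℝ ψ w).le_opNorm k
    rw [hk, mul_one] at this
    exact this.trans hl
  have hH : ∀ x k : E3, ‖k‖ = 1 → |fderiv ℝ (fderiv ℝ ψ) x k k| ≤ D := by
    intro x k hk
    have := (fderiv ℝ (fderiv ℝ ψ) x).le_opNorm₂ k k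
    rw [hk, mul_one, mul_one] at this
    exact this.trans (hHn x)
  refine ⟨2 * π * D + C * |R|, by positivity, fun v w k h i hk hh hi hvw hR θ hθ0 hθ1 => ?_⟩
  refine (abs_le_of_expansion (by positivity) (hC v w k h i hk hh hi hvw) hθ0 hθ1).trans ?_
  gcongr
  have hr := norm_nonneg (v - w)
  have hπ := Real.pi_pos
  have a1 := hP v w k hk
  have a2 := (abs_add_le _ _).trans (add_le_add (hH v k hk) (hH w k hk))
  have a3 := (abs_add_le _ _).trans (add_le_add
    ((abs_add_le _ _).trans (add_le_add (hH v h hh) (hH w h hh)))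
    ((abs_add_le _ _).trans (add_le_add (hH v i hi) (hH w i hi))))
  rw [abs_mul (π * ‖v - w‖), abs_mul (π * ‖v - w‖ ^ 2 / 4), abs_mul (π * ‖v - w‖ ^ 2 / 8),
    abs_of_nonneg (by positivity : 0 ≤ π * ‖v - w‖),
    abs_of_nonneg (by positivity : 0 ≤ π * ‖v - w‖ ^ 2 / 4),
    abs_of_nonneg (by positivity : 0 ≤ π * ‖v - w‖ ^ 2 / 8)]
  have a4 : C * ‖v - w‖ ^ 3 ≤ C * |R| * ‖v - w‖ ^ 2 := by
    have := hR.trans (le_abs_self R)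
    calc C * ‖v - w‖ ^ 3 = C * (‖v - w‖ * ‖v - w‖ ^ 2) := by ring
      _ ≤ C * (|R| * ‖v - w‖ ^ 2) := by gcongr
      _ = _ := by ring
  calc _ ≤ π * ‖v - w‖ * (D * ‖v - w‖) + π * ‖v - w‖ ^ 2 / 4 * (D + D)
        + π * ‖v - w‖ ^ 2 / 8 * (D + D + (D + D)) + C * |R| * ‖v - w‖ ^ 2 := by gcongr
    _ = _ := by ring

theorem tendsto_angularAverage_div_sq {ψ : E3 → ℝ} (hψ : ContDiff ℝ (⊤ : ℕ∞) ψ)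
    (hψc : HasCompactSupport ψ) (γ : ℝ) {v w k h i : E3} (hvw : v ≠ w)
    (hk : ‖k‖ = 1) (hh : ‖h‖ = 1) (hi : ‖i‖ = 1)
    (hkh : ⟪k, h⟫ = 0) (hki : ⟪k, i⟫ = 0) (hhi : ⟪h, i⟫ = 0) (hkvw : v - w = ‖v - w‖ • k) :
    Tendsto (fun θ => angularAverage ψ v w k h i θ / θ ^ 2) (𝓝[>] 0)
      (𝓝 (π / 8 * (‖v - w‖ ^ (-γ) * divDiff (fun r : E3 × E3 => (‖r.1 - r.2‖ ^ (2 + γ)) •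
        projPerp (r.1 - r.2) (gradient ψ r.1 - gradient ψ r.2)) v w))) := by
  obtain ⟨C, hC0, hC⟩ := exists_angularAverage_expansion hψ hψc
  have hpos : 0 < ‖v - w‖ := norm_pos_iff.2 (sub_ne_zero.2 hvw)
  have hg : ‖v - w‖ ^ (-γ) * ‖v - w‖ ^ γ = 1 := by
    rw [← Real.rpow_add hpos]; simp
  convert tendsto_div_sq_of_expansion (hC v w k h i hk hh hi hkvw) using 2
  rw [divDiff_eq hψ γ hvw hk hh hi hkh hki hhi hkvw, ← mul_assoc, ← mul_assoc, mul_assoc (π / 8),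
    hg]
  ring

theorem norm_unitK {v w : E3} (hvw : v ≠ w) : ‖unitK v w‖ = 1 := by
  have hpos : ‖v - w‖ ≠ 0 := norm_ne_zero_iff.2 (sub_ne_zero.2 hvw)
  rw [unitK, norm_smul, norm_inv, norm_norm, inv_mul_cancel₀ hpos]

theorem sub_eq_norm_smul_unitK {v w : E3} (hvw : v ≠ w) : v - w = ‖v - w‖ • unitK v w := by
  have hpos : ‖v - w‖ ≠ 0 := norm_ne_zero_iff.2 (sub_ne_zero.2 hvw)
  rw [unitK, smul_smul, mul_inv_cancel₀ hpos, one_smul]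

theorem measurable_uncurry_angularAverage {ψ : E3 → ℝ} (hψ : Continuous ψ)
    {h i : E3 × E3 → E3} (hhm : Measurable h) (him : Measurable i) :
    Measurable (fun p : (E3 × E3) × ℝ =>
      angularAverage ψ p.1.1 p.1.2 (unitK p.1.1 p.1.2) (h p.1) (i p.1) p.2) := by
  have hψm := hψ.measurable
  refine StronglyMeasurable.measurable ?_
  unfold angularAverage
  refine StronglyMeasurable.integral_prod_right (f := fun (p : (E3 × E3) × ℝ) (φ : ℝ) =>
    ψ (vPost p.1.1 p.1.2 (sigmaDir (unitK p.1.1 p.1.2) (h p.1) (i p.1) p.2 φ))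
      + ψ (vPostStar p.1.1 p.1.2 (sigmaDir (unitK p.1.1 p.1.2) (h p.1) (i p.1) p.2 φ))
      - ψ p.1.1 - ψ p.1.2) (Measurable.stronglyMeasurable ?_)
  unfold Function.uncurry vPost vPostStar sigmaDir unitK
  fun_prop

/-- Grazing collision limit of the weak form of the Boltzmann collision operator:
for `f` bounded measurable compactly supported nonnegative and `ψ ∈ C_c^∞(ℝ³)`, the
tested Boltzmann collision operator with kernel `B^ε` (with `β^ε(θ) = (π³/ε³)β(πθ/ε)`)
converges, as `ε ↓ 0`, to the tested Landau collision operator. -/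
theorem grazing_collision_limit_of_tested_collision_operator
    (γ : ℝ) (hγ : γ ∈ Set.Ico (-4 : ℝ) 0)
    (β : ℝ → ℝ) (hβm : Measurable β) (hβ0 : ∀ θ, 0 ≤ β θ)
    (hβnorm : ∫ θ in Set.Ioc (0:ℝ) (π / 2), θ ^ 2 * β θ = 8 / π)
    (f : E3 → ℝ) (hfm : Measurable f) (hf0 : ∀ v, 0 ≤ f v)
    (hfb : ∃ C, ∀ v, f v ≤ C) (hfc : HasCompactSupport f)
    (ψ : E3 → ℝ) (hψ : ContDiff ℝ (⊤ : ℕ∞) ψ) (hψc : HasCompactSupport ψ)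
    (h i : E3 × E3 → E3) (hhm : Measurable h) (him : Measurable i)
    (honb : ∀ v w : E3, v ≠ w →
      ‖h (v, w)‖ = 1 ∧ ‖i (v, w)‖ = 1 ∧
        ⟪unitK v w, h (v, w)⟫ = 0 ∧ ⟪unitK v w, i (v, w)⟫ = 0 ∧
        ⟪h (v, w), i (v, w)⟫ = 0) :
    Filter.Tendsto (fun ε : ℝ =>
        (1 / 2 : ℝ) * ∫ q : E3 × E3, f q.1 * f q.2 * ‖q.1 - q.2‖ ^ γ *
          ∫ θ in Set.Ioc (0:ℝ) (ε / 2), (π ^ 3 / ε ^ 3) * β (π * θ / ε) *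
            ∫ φ in Set.Ioc (0:ℝ) (2 * π),
              (ψ (vPost q.1 q.2 (sigmaDir (unitK q.1 q.2) (h q) (i q) θ φ))
                + ψ (vPostStar q.1 q.2 (sigmaDir (unitK q.1 q.2) (h q) (i q) θ φ))
                - ψ q.1 - ψ q.2))
      (𝓝[>] (0 : ℝ))
      (𝓝 ((1 / 2 : ℝ) * ∫ q : E3 × E3, f q.1 * f q.2 *
        divDiff (fun r : E3 × E3 =>
            (‖r.1 - r.2‖ ^ (2 + γ)) •
              projPerp (r.1 - r.2) (gradient ψ r.1 - gradient ψ r.2)) q.1 q.2)) := by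
  have hβi : IntegrableOn (fun θ => θ ^ 2 * β θ) (Set.Ioc (0 : ℝ) (π / 2)) := by
    by_contra hn
    rw [integral_undef hn] at hβnorm
    have : 0 < 8 / π := by positivity
    exact this.ne hβnorm
  obtain ⟨M, hM⟩ := hfb
  have hM0 : 0 ≤ M := (hf0 0).trans (hM 0)
  obtain ⟨R, hR⟩ := hfc.isCompact.isBounded.subset_ball 0
  have hfR : ∀ v, f v ≠ 0 → ‖v‖ < R := fun v hv => by
    simpa using hR (subset_tsupport f hv)
  obtain ⟨C, hC0, hC⟩ := exists_abs_angularAverage_le hψ hψc (R + R)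
  have hm := measurable_uncurry_angularAverage hψ.continuous hhm him
  have hε01 : ∀ᶠ ε : ℝ in 𝓝[>] 0, 0 < ε ∧ ε ≤ 1 := by
    filter_upwards [Ioc_mem_nhdsGT (zero_lt_one (α := ℝ))] with ε hε using hε
  refine Tendsto.const_mul (1 / 2 : ℝ) ?_
  change Tendsto (fun ε : ℝ => ∫ q : E3 × E3, f q.1 * f q.2 * ‖q.1 - q.2‖ ^ γ *
    ∫ θ in Set.Ioc (0:ℝ) (ε / 2), (π ^ 3 / ε ^ 3) * β (π * θ / ε) *
      angularAverage ψ q.1 q.2 (unitK q.1 q.2) (h q) (i q) θ) _ _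
  refine tendsto_integral_filter_of_dominated_convergence
    (fun q : E3 × E3 => (M * M * (C * (8 / π))) *
      ((Metric.ball (0 : E3) R).indicator (fun _ => (1 : ℝ)) q.2 *
        (Metric.ball (0 : E3) (R + R)).indicator (fun x => ‖x‖ ^ (2 + γ)) (q.1 - q.2)))
    ?_ ?_ ((integrable_indicator_mul_norm_sub_rpow (by linarith [hγ.1]) R (R + R)).const_mul _) ?_
  · refine Eventually.of_forall fun ε => Measurable.aestronglyMeasurable ?_
    have hθ : Measurable fun q : E3 × E3 => ∫ θ in Set.Ioc (0:ℝ) (ε / 2),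
        (π ^ 3 / ε ^ 3) * β (π * θ / ε) *
          angularAverage ψ q.1 q.2 (unitK q.1 q.2) (h q) (i q) θ := by
      refine StronglyMeasurable.measurable (StronglyMeasurable.integral_prod_right
        (f := fun (q : E3 × E3) (θ : ℝ) => (π ^ 3 / ε ^ 3) * β (π * θ / ε) *
          angularAverage ψ q.1 q.2 (unitK q.1 q.2) (h q) (i q) θ)
        (Measurable.stronglyMeasurable ?_))
      have hβ' : Measurable fun p : (E3 × E3) × ℝ => (π ^ 3 / ε ^ 3) * β (π * p.2 / ε) := by
        fun_prop
      exact hβ'.mul hm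
    have hpre : Measurable fun q : E3 × E3 => f q.1 * f q.2 * ‖q.1 - q.2‖ ^ γ := by
      fun_prop
    exact hpre.mul hθ
  · filter_upwards [hε01] with ε hε
    filter_upwards [ae_fst_ne_snd] with q hq
    obtain ⟨hh, hi, hkh, hki, hhi⟩ := honb q.1 q.2 hq
    have hz : 0 < ‖q.1 - q.2‖ := norm_pos_iff.2 (sub_ne_zero.2 hq)
    by_cases h0 : f q.1 * f q.2 = 0
    · rw [h0, zero_mul, zero_mul, norm_zero]
      have h1 : 0 ≤ (Metric.ball (0 : E3) R).indicator (fun _ => (1 : ℝ)) q.2 :=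
        Set.indicator_nonneg (fun _ _ => zero_le_one) _
      have h2 : 0 ≤ (Metric.ball (0 : E3) (R + R)).indicator (fun x => ‖x‖ ^ (2 + γ))
          (q.1 - q.2) :=
        Set.indicator_nonneg (fun _ _ => by positivity) _
      positivity
    · have h1 := hfR q.1 (left_ne_zero_of_mul h0)
      have h2 := hfR q.2 (right_ne_zero_of_mul h0)
      have h12 : ‖q.1 - q.2‖ < R + R := (norm_sub_le _ _).trans_lt (add_lt_add h1 h2)
      rw [Set.indicator_of_mem (by simpa using h2), Set.indicator_of_mem (by simpa using h12),
        one_mul, add_comm 2 γ, Real.rpow_add hz, norm_mul, norm_mul, norm_mul,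
        Real.norm_of_nonneg (hf0 q.1), Real.norm_of_nonneg (hf0 q.2),
        Real.norm_of_nonneg (Real.rpow_nonneg hz.le γ), Real.norm_eq_abs]
      have hI := abs_scaled_angular_integral_le hβ0 hβi
        (hC q.1 q.2 _ _ _ (norm_unitK hq) hh hi (sub_eq_norm_smul_unitK hq) h12.le) hε.1 hε.2
      rw [hβnorm] at hI
      calc f q.1 * f q.2 * ‖q.1 - q.2‖ ^ γ * _
          ≤ M * M * ‖q.1 - q.2‖ ^ γ * (C * ‖q.1 - q.2‖ ^ 2 * (8 / π)) := by
            gcongr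
            exacts [hf0 q.2, hM _, hM _]
        _ = _ := by
            rw [Real.rpow_two]
            ring
  · filter_upwards [ae_fst_ne_snd] with q hq
    obtain ⟨hh, hi, hkh, hki, hhi⟩ := honb q.1 q.2 hq
    have hz : 0 < ‖q.1 - q.2‖ := norm_pos_iff.2 (sub_ne_zero.2 hq)
    by_cases h0 : f q.1 * f q.2 = 0
    · simp [h0]
    · have h1 := hfR q.1 (left_ne_zero_of_mul h0)
      have h2 := hfR q.2 (right_ne_zero_of_mul h0)
      have h12 : ‖q.1 - q.2‖ < R + R := (norm_sub_le _ _).trans_lt (add_lt_add h1 h2)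
      have hgm := hm.comp (measurable_prodMk_left (x := q))
      simp only [Function.comp_def] at hgm
      have hL := tendsto_angularAverage_div_sq hψ hψc γ hq (norm_unitK hq) hh hi hkh hki hhi
        (sub_eq_norm_smul_unitK hq)
      have hgC := hC q.1 q.2 _ _ _ (norm_unitK hq) hh hi (sub_eq_norm_smul_unitK hq) h12.le
      have hlim := tendsto_scaled_angular_integral hβm hβ0 hβi hgm hgC hL
      convert hlim.const_mul (f q.1 * f q.2 * ‖q.1 - q.2‖ ^ γ) using 2
      rw [hβnorm]
      have hg : ‖q.1 - q.2‖ ^ γ * ‖q.1 - q.2‖ ^ (-γ) = 1 := by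
        rw [← Real.rpow_add hz]; simp
      have hc : π / 8 * (8 / π) = 1 := by field_simp
      generalize divDiff _ _ _ = D
      linear_combination -(f q.1 * f q.2 * D * (π / 8 * (8 / π))) * hg - f q.1 * f q.2 * D * hc
end
end

section
/- Let ν ∈ (0, 2), c₁ > 0, and let β : (0, π/2] → [0, ∞) be measurable with β(θ) ≥ c₁ θ^{−1−ν} for all θ ∈ (0, π/2]; for ε ∈ (0, 1] set β^ε(θ) = (π³/ε³) β(πθ/ε) for θ ∈ (0, ε/2] and β^ε(θ) = 0 otherwise. Then for every ξ ∈ ℝ³, ξ ≠ 0, and every ε ∈ (0, 1], one has ∫_{S²} g(σ) dσ ≥ (2c₁/π) · ((π/2)^{2−ν}/(2−ν)) · min(|ξ|², |ξ|^ν), where the integral is with respect to the surface measure on the unit sphere S² ⊂ ℝ³ and, for σ ∈ S² with θ = arccos((ξ/|ξ|)·σ) ∈ (0, π], g(σ) = (β^ε(θ)/sin θ) · min(|ξ⁻|², 1) with ξ⁻ = (ξ − |ξ|σ)/2, and g(σ) = 0 when θ ∉ (0, ε/2]. -/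
noncomputable section
open Real MeasureTheory
open scoped RealInnerProductSpace ENNReal

/-- The rescaled grazing angular kernel `β^ε(θ) = (π³/ε³) β(πθ/ε)` for `θ ∈ (0, ε/2]`,
extended by `0` elsewhere. -/
def betaEps (β : ℝ → ℝ) (ε θ : ℝ) : ℝ :=
  if θ ∈ Set.Ioc (0:ℝ) (ε / 2) then (π ^ 3 / ε ^ 3) * β (π * θ / ε) else 0

/-- Integration of a radial function on the plane. -/
lemma lintegral_radial_plane {h : ℝ → ℝ≥0∞} (hh : Measurable h) :
    ∫⁻ p : ℝ × ℝ, h (√(p.1 ^ 2 + p.2 ^ 2)) =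
      ENNReal.ofReal (2 * π) * ∫⁻ ρ in Set.Ioi (0 : ℝ), ENNReal.ofReal ρ * h ρ := by
  rw [← lintegral_comp_polarCoord_symm, polarCoord_target]
  have key : ∀ p ∈ Set.Ioi (0 : ℝ) ×ˢ Set.Ioo (-π) π,
      ENNReal.ofReal p.1 • h (√((polarCoord.symm p).1 ^ 2 + (polarCoord.symm p).2 ^ 2)) =
        (ENNReal.ofReal p.1 * h p.1) * 1 := by
    rintro ⟨r, θ⟩ ⟨hr, -⟩
    have hr : 0 < r := hr
    have : (r * cos θ) ^ 2 + (r * sin θ) ^ 2 = r ^ 2 := by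
      linear_combination r ^ 2 * sin_sq_add_cos_sq θ
    simp [polarCoord_symm_apply, this, sqrt_sq hr.le]
  rw [setLIntegral_congr_fun (measurableSet_Ioi.prod measurableSet_Ioo) key,
    Measure.volume_eq_prod, ← Measure.prod_restrict,
    lintegral_prod_mul (f := fun r ↦ ENNReal.ofReal r * h r) (g := fun _ ↦ 1)
      (by fun_prop) (by fun_prop)]
  simp only [lintegral_one, Measure.restrict_apply_univ, Real.volume_Ioo]
  rw [mul_comm]
  ring_nf

/-- Polar coordinates on the half-plane `{(z, ρ) | 0 < ρ}`. -/
lemma lintegral_halfPlane_polar {K : ℝ × ℝ → ℝ≥0∞} (hK : Measurable K) :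
    ∫⁻ z : ℝ, ∫⁻ ρ in Set.Ioi (0 : ℝ), K (z, ρ) =
      ∫⁻ p in Set.Ioi (0 : ℝ) ×ˢ Set.Ioo 0 π,
        ENNReal.ofReal p.1 * K (p.1 * cos p.2, p.1 * sin p.2) := by
  have h1 : ∫⁻ z : ℝ, ∫⁻ ρ in Set.Ioi (0 : ℝ), K (z, ρ) =
      ∫⁻ p : ℝ × ℝ, (Set.univ ×ˢ Set.Ioi (0 : ℝ)).indicator K p := by
    rw [lintegral_indicator (MeasurableSet.univ.prod measurableSet_Ioi), Measure.volume_eq_prod,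
      ← Measure.prod_restrict, lintegral_prod _ hK.aemeasurable, Measure.restrict_univ]
  rw [h1, ← lintegral_comp_polarCoord_symm, polarCoord_target,
    ← lintegral_indicator (measurableSet_Ioi.prod measurableSet_Ioo),
    ← lintegral_indicator (measurableSet_Ioi.prod measurableSet_Ioo)]
  congr 1
  ext ⟨r, θ⟩
  by_cases hr : 0 < r
  · by_cases hθ : θ ∈ Set.Ioo 0 π
    · have hs := sin_pos_of_mem_Ioo hθ
      have hθ' : -π < θ := by linarith [hθ.1, pi_pos]
      simp [Set.indicator, hr, hθ.1, hθ.2, hθ', hs]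
    · by_cases hθ' : θ ∈ Set.Ioo (-π) π
      · have h0 : θ ≤ 0 := by
          by_contra! h
          exact hθ ⟨h, hθ'.2⟩
        have hs := sin_nonpos_of_nonpos_of_neg_pi_le h0 hθ'.1.le
        have : ¬ 0 < r * sin θ := not_lt.2 (mul_nonpos_of_nonneg_of_nonpos hr.le hs)
        simp [Set.indicator, h0.not_gt, this]
      · have h1 : ¬ (-π < θ ∧ θ < π) := hθ'
        have h2 : ¬ (0 < θ ∧ θ < π) := hθ
        simp [Set.indicator, h1, h2]
  · simp [Set.indicator, hr]

/-- Cylindrical coordinates around the axis of the unit vector `u`. -/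
lemma lintegral_inner_norm_eq {u : E3} (hu : ‖u‖ = 1) {H : ℝ × ℝ → ℝ≥0∞} (hH : Measurable H) :
    ∫⁻ x : E3, H (⟪u, x⟫, ‖x‖) = ENNReal.ofReal (2 * π) *
      ∫⁻ z : ℝ, ∫⁻ ρ in Set.Ioi (0 : ℝ), ENNReal.ofReal ρ * H (z, √(z ^ 2 + ρ ^ 2)) := by
  obtain ⟨b, hb⟩ : ∃ b : OrthonormalBasis (Fin 3) ℝ E3, b 0 = u := by
    obtain ⟨b, hb⟩ := Orthonormal.exists_orthonormalBasis_extension_of_card_eq (𝕜 := ℝ) (E := E3)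
      (ι := Fin 3) (by simp) (v := fun _ ↦ u) (s := {0})
      ⟨fun _ ↦ hu, fun i j hij ↦ (hij (Subsingleton.elim _ _)).elim⟩
    exact ⟨b, hb 0 rfl⟩
  have hmp : MeasurePreserving (fun x : E3 ↦
      MeasurableEquiv.piFinSuccAbove (fun _ : Fin 3 ↦ ℝ) 0 (WithLp.ofLp (b.repr x))) :=
    (volume_preserving_piFinSuccAbove (fun _ : Fin 3 ↦ ℝ) 0).comp
      ((PiLp.volume_preserving_ofLp (Fin 3)).comp b.measurePreserving_repr)
  have hmp2 : MeasurePreserving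
      (Prod.map id (MeasurableEquiv.finTwoArrow (α := ℝ)) : ℝ × (Fin 2 → ℝ) → ℝ × (ℝ × ℝ)) :=
    (MeasurePreserving.id volume).prod (volume_preserving_finTwoArrow ℝ)
  have hG : Measurable fun q : ℝ × (ℝ × ℝ) ↦ H (q.1, √(q.1 ^ 2 + √(q.2.1 ^ 2 + q.2.2 ^ 2) ^ 2)) := by
    fun_prop
  have hcomp := (hmp2.comp hmp).lintegral_comp hG
  have hx : ∀ x : E3, H (⟪u, x⟫, ‖x‖) = (fun q : ℝ × (ℝ × ℝ) ↦
      H (q.1, √(q.1 ^ 2 + √(q.2.1 ^ 2 + q.2.2 ^ 2) ^ 2)))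
      ((Prod.map id (MeasurableEquiv.finTwoArrow (α := ℝ)) ∘ fun x : E3 ↦
      MeasurableEquiv.piFinSuccAbove (fun _ : Fin 3 ↦ ℝ) 0 (WithLp.ofLp (b.repr x))) x) := by
    intro x
    have h0 : ⟪u, x⟫ = b.repr x 0 := by rw [b.repr_apply_apply, hb]
    have hn : ‖x‖ = √((b.repr x 0) ^ 2 + ((b.repr x 1) ^ 2 + (b.repr x 2) ^ 2)) := by
      rw [← b.repr.norm_map x, EuclideanSpace.norm_eq, Fin.sum_univ_three]
      simp [add_assoc]
    rw [h0, hn]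
    simp only [Function.comp_apply, Prod.map]
    rw [sq_sqrt (by positivity)]
    rfl
  simp_rw [hx]
  rw [hcomp, Measure.volume_eq_prod, lintegral_prod _ hG.aemeasurable,
    ← lintegral_const_mul _ (by fun_prop)]
  congr 1
  ext z
  exact lintegral_radial_plane (h := fun ρ ↦ H (z, √(z ^ 2 + ρ ^ 2))) (by fun_prop)

/-- Archimedes' formula for zonal functions on the unit sphere of `ℝ³`. -/
lemma lintegral_toSphere_inner {u : E3} (hu : ‖u‖ = 1) {F : ℝ → ℝ≥0∞} (hF : Measurable F) :
    ∫⁻ σ : Metric.sphere (0 : E3) 1, F ⟪u, (σ : E3)⟫ ∂((volume : Measure E3).toSphere) =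
      ENNReal.ofReal (2 * π) * ∫⁻ θ in Set.Ioo 0 π, ENNReal.ofReal (sin θ) * F (cos θ) := by
  set χ : ℝ → ℝ≥0∞ := (Set.Iio 1).indicator 1 with hχ_def
  have hχ : Measurable χ := measurable_one.indicator measurableSet_Iio
  set W : ℝ≥0∞ := ∫⁻ r in Set.Ioi (0 : ℝ), ENNReal.ofReal (r ^ 2) * χ r with hW_def
  have hvol : ∫⁻ r : Set.Ioi (0 : ℝ), χ r ∂(Measure.volumeIoiPow 2) = W := by
    rw [Measure.volumeIoiPow, lintegral_withDensity_eq_lintegral_mul _ (by fun_prop) (by fun_prop)]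
    exact lintegral_subtype_comap measurableSet_Ioi fun r ↦ ENNReal.ofReal (r ^ 2) * χ r
  have hW : W = ENNReal.ofReal (1 / 3) := by
    rw [← hvol]
    have : (fun r : Set.Ioi (0 : ℝ) ↦ χ r) =
        (Set.Iio (⟨1, Set.mem_Ioi.2 one_pos⟩ : Set.Ioi (0 : ℝ))).indicator 1 := by
      ext r
      simp [hχ_def, Set.indicator, ← Subtype.coe_lt_coe]
    rw [this, lintegral_indicator_one measurableSet_Iio, Measure.volumeIoiPow_apply_Iio]
    norm_num
  have hsphere : ∫⁻ x : E3, F (⟪u, x⟫ / ‖x‖) * χ ‖x‖ =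
      (∫⁻ σ : Metric.sphere (0 : E3) 1, F ⟪u, (σ : E3)⟫ ∂((volume : Measure E3).toSphere)) * W := by
    have hcomp := (volume : Measure E3).measurePreserving_homeomorphUnitSphereProd.lintegral_comp
      (f := fun q ↦ F ⟪u, (q.1 : E3)⟫ * χ q.2) (by fun_prop)
    rw [lintegral_prod_mul (f := fun σ : Metric.sphere (0 : E3) 1 ↦ F ⟪u, (σ : E3)⟫)
      (g := fun r : Set.Ioi (0 : ℝ) ↦ χ r) (by fun_prop) (by fun_prop)] at hcomp
    simp only [finrank_euclideanSpace, Fintype.card_fin, Nat.add_one_sub_one] at hcomp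
    rw [← hvol, ← hcomp]
    simp only [homeomorphUnitSphereProd_apply_fst_coe, homeomorphUnitSphereProd_apply_snd_coe,
      inner_smul_right]
    rw [lintegral_subtype_comap (measurableSet_singleton _).compl
      fun x : E3 ↦ F (‖x‖⁻¹ * ⟪u, x⟫) * χ ‖x‖, restrict_compl_singleton]
    simp only [div_eq_inv_mul]
  have hpolar : ∫⁻ x : E3, F (⟪u, x⟫ / ‖x‖) * χ ‖x‖ = (ENNReal.ofReal (2 * π) *
      ∫⁻ θ in Set.Ioo 0 π, ENNReal.ofReal (sin θ) * F (cos θ)) * W := by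
    rw [lintegral_inner_norm_eq hu (H := fun q ↦ F (q.1 / q.2) * χ q.2) (by fun_prop),
      lintegral_halfPlane_polar (K := fun q ↦ ENNReal.ofReal q.2 *
        (F (q.1 / √(q.1 ^ 2 + q.2 ^ 2)) * χ √(q.1 ^ 2 + q.2 ^ 2))) (by fun_prop)]
    have key : ∀ p ∈ Set.Ioi (0 : ℝ) ×ˢ Set.Ioo 0 π,
        ENNReal.ofReal p.1 * (ENNReal.ofReal (p.1 * sin p.2) *
          (F (p.1 * cos p.2 / √((p.1 * cos p.2) ^ 2 + (p.1 * sin p.2) ^ 2)) *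
            χ √((p.1 * cos p.2) ^ 2 + (p.1 * sin p.2) ^ 2))) =
        (ENNReal.ofReal (p.1 ^ 2) * χ p.1) * (ENNReal.ofReal (sin p.2) * F (cos p.2)) := by
      rintro ⟨r, θ⟩ ⟨hr, -⟩
      have hr : 0 < r := hr
      have : (r * cos θ) ^ 2 + (r * sin θ) ^ 2 = r ^ 2 := by
        linear_combination r ^ 2 * sin_sq_add_cos_sq θ
      simp only [this, sqrt_sq hr.le, mul_div_cancel_left₀ _ hr.ne', ENNReal.ofReal_mul hr.le,
        ENNReal.ofReal_pow hr.le]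
      ring
    rw [setLIntegral_congr_fun (measurableSet_Ioi.prod measurableSet_Ioo) key,
      Measure.volume_eq_prod, ← Measure.prod_restrict,
      lintegral_prod_mul (f := fun r ↦ ENNReal.ofReal (r ^ 2) * χ r)
        (g := fun θ ↦ ENNReal.ofReal (sin θ) * F (cos θ)) (by fun_prop) (by fun_prop), ← hW_def]
    ring
  refine (ENNReal.mul_left_inj (c := W) ?_ ?_).1 (hsphere.symm.trans hpolar)
  · rw [hW]; norm_num
  · rw [hW]; exact ENNReal.ofReal_ne_top

/-- Truncating the angular variable at `(π/2) min(1, 1/s)` produces the weight `min(s², s^ν)`. -/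
lemma rpow_mul_min_le_sq_mul_rpow_min {ν s : ℝ} (hs : 0 < s) :
    (π / 2) ^ (2 - ν) * min (s ^ 2) (s ^ ν) ≤ s ^ 2 * (min (π / 2) (π / 2 / s)) ^ (2 - ν) := by
  rcases le_total s 1 with h | h
  · rw [min_eq_left (le_div_self (by positivity) hs h), mul_comm]
    gcongr
    exact min_le_left _ _
  · rw [min_eq_right (div_le_self (by positivity) h), div_rpow (by positivity) hs.le]
    have h2 : s ^ 2 / s ^ (2 - ν) = s ^ ν := by
      rw [← rpow_natCast s 2, ← rpow_sub hs]
      norm_num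
    calc (π / 2) ^ (2 - ν) * min (s ^ 2) (s ^ ν) ≤ (π / 2) ^ (2 - ν) * s ^ ν := by
          gcongr
          exact min_le_right _ _
      _ = s ^ 2 * ((π / 2) ^ (2 - ν) / s ^ (2 - ν)) := by rw [← h2]; ring

/-- On the truncated angular range the integrand dominates a power of the rescaled angle. -/
lemma rpow_le_betaEps_mul_min {ν c₁ : ℝ} (hc₁ : 0 < c₁) {β : ℝ → ℝ}
    (hβlow : ∀ θ ∈ Set.Ioc (0:ℝ) (π / 2), c₁ * θ ^ (-1 - ν) ≤ β θ)
    {s : ℝ} (hs : 0 < s) {ε : ℝ} (hε : ε ∈ Set.Ioc (0:ℝ) 1) {θ : ℝ}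
    (hθ : θ ∈ Set.Ioc (0:ℝ) (ε * min (π / 2) (π / 2 / s) / π)) :
    c₁ * s ^ 2 / (π * ε) * (π * θ / ε) ^ (1 - ν) ≤
      betaEps β ε θ * min (s ^ 2 * ((1 - cos θ) / 2)) 1 := by
  obtain ⟨hε0, hε1⟩ := hε
  obtain ⟨hθ0, hθ1⟩ := hθ
  have hπ := pi_pos
  have hφ : π * θ / ε ≤ min (π / 2) (π / 2 / s) := by
    rw [le_div_iff₀ hπ] at hθ1
    rw [div_le_iff₀ hε0]
    linarith
  have hφ1 : π * θ / ε ≤ π / 2 := hφ.trans (min_le_left _ _)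
  have hφ2 : π * θ / ε ≤ π / 2 / s := hφ.trans (min_le_right _ _)
  have hφ0 : 0 < π * θ / ε := by positivity
  have hθε : θ ≤ ε / 2 := by
    rw [div_le_iff₀ hε0] at hφ1
    nlinarith
  have hβ := hβlow _ ⟨hφ0, hφ1⟩
  have hsθ : s * (θ / π) ≤ 1 := by
    rw [le_div_iff₀ hs, div_mul_eq_mul_div, div_le_iff₀ hε0] at hφ2
    have h3 : s * θ ≤ ε / 2 := by nlinarith
    rw [← mul_div_assoc, div_le_one hπ]
    linarith [pi_gt_three]
  have hcos : (θ / π) ^ 2 ≤ (1 - cos θ) / 2 := by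
    have := cos_le_one_sub_mul_cos_sq (x := θ) (by
      rw [abs_of_pos hθ0]; linarith [pi_gt_three])
    rw [div_pow]
    have h4 : 2 / π ^ 2 * θ ^ 2 = 2 * (θ ^ 2 / π ^ 2) := by ring
    linarith
  have hmin : s ^ 2 * (θ / π) ^ 2 ≤ min (s ^ 2 * ((1 - cos θ) / 2)) 1 := by
    refine le_min (by gcongr) ?_
    rw [← mul_pow]
    exact pow_le_one₀ (by positivity) hsθ
  have hpow : (π * θ / ε) ^ (1 - ν) = (π * θ / ε) ^ (-1 - ν) * (π * θ / ε) ^ 2 := by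
    rw [← rpow_natCast (π * θ / ε) 2, ← rpow_add hφ0]
    congr 1
    push_cast
    ring
  rw [betaEps, if_pos ⟨hθ0, hθε⟩]
  calc c₁ * s ^ 2 / (π * ε) * (π * θ / ε) ^ (1 - ν)
      = π ^ 3 / ε ^ 3 * (c₁ * (π * θ / ε) ^ (-1 - ν)) * (s ^ 2 * (θ / π) ^ 2) := by
        rw [hpow]
        field_simp
    _ ≤ _ := by
        have : 0 ≤ c₁ * (π * θ / ε) ^ (-1 - ν) := by positivity
        have h5 := this.trans hβ
        gcongr

/-- The integral of a power of the rescaled angle. -/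
lemma lintegral_rescaled_rpow {ν C a ε : ℝ} (hν : ν < 2) (hC : 0 ≤ C) (ha : 0 < a) (hε : 0 < ε) :
    ∫⁻ θ in Set.Ioc 0 (ε * a / π), ENNReal.ofReal (C * (π * θ / ε) ^ (1 - ν)) =
      ENNReal.ofReal (C * (ε / π) * (a ^ (2 - ν) / (2 - ν))) := by
  have hπ := pi_pos
  have hδ : 0 ≤ ε * a / π := by positivity
  have hfi : IntervalIntegrable (fun θ : ℝ ↦ C * (π * θ / ε) ^ (1 - ν)) volume 0 (ε * a / π) := by
    have h := (intervalIntegral.intervalIntegrable_rpow' (a := 0) (b := a) (r := 1 - ν)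
      (by linarith)).comp_mul_left (c := π / ε)
    have h2 := h.const_mul C
    have e1 : a / (π / ε) = ε * a / π := by field_simp
    simpa [e1, div_mul_eq_mul_div] using h2
  rw [← ofReal_integral_eq_lintegral_ofReal hfi.1, ← intervalIntegral.integral_of_le hδ]
  · congr 1
    have e : (fun θ : ℝ ↦ C * (π * θ / ε) ^ (1 - ν)) = fun θ ↦ C * ((π / ε) * θ) ^ (1 - ν) := by
      ext θ
      rw [div_mul_eq_mul_div]
    rw [e, intervalIntegral.integral_const_mul,
      intervalIntegral.integral_comp_mul_left (fun x ↦ x ^ (1 - ν)) (by positivity),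
      integral_rpow (Or.inl (by linarith))]
    have e1 : π / ε * (ε * a / π) = a := by field_simp
    have e2 : 1 - ν + 1 = 2 - ν := by ring
    rw [e1, e2, mul_zero, zero_rpow (by linarith), sub_zero, inv_div, smul_eq_mul, mul_assoc]
  · filter_upwards [ae_restrict_mem measurableSet_Ioc] with θ hθ
    have := hθ.1
    simp only [Pi.zero_apply]
    positivity

lemma measurable_betaEps {β : ℝ → ℝ} (hβ : Measurable β) (ε : ℝ) : Measurable (betaEps β ε) :=
  Measurable.ite measurableSet_Ioc (by fun_prop) measurable_const

/-- The squared norm of `ξ⁻ = (ξ - |ξ|σ)/2` is a function of the deviation angle. -/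
lemma norm_sq_half_sub_norm_smul {ξ : E3} (hξ : ξ ≠ 0) {σ : E3} (hσ : ‖σ‖ = 1) :
    ‖(2⁻¹ : ℝ) • (ξ - ‖ξ‖ • σ)‖ ^ 2 = ‖ξ‖ ^ 2 * ((1 - ⟪‖ξ‖⁻¹ • ξ, σ⟫) / 2) := by
  have h : ‖ξ‖ ≠ 0 := norm_ne_zero_iff.2 hξ
  rw [norm_smul, mul_pow, norm_sub_sq_real, norm_smul, inner_smul_right, real_inner_smul_left, hσ]
  simp only [norm_inv, norm_norm, Real.norm_ofNat]
  field_simp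
  ring

/-- Coercivity of the spherical average of the grazing collision kernel in Fourier
variables: for `ξ ≠ 0` and `ε ∈ (0,1]`,
`∫_{S²} (β^ε(θ)/sin θ) min(|ξ⁻|², 1) dσ ≥ (2c₁/π)((π/2)^{2−ν}/(2−ν)) min(|ξ|², |ξ|^ν)`,
where `θ = arccos((ξ/|ξ|)·σ)`, `ξ⁻ = (ξ − |ξ|σ)/2`, and the integral is with respect to
the surface measure on the unit sphere. -/
theorem spherical_average_coercivity
    (ν : ℝ) (hν : ν ∈ Set.Ioo (0:ℝ) 2) (c₁ : ℝ) (hc₁ : 0 < c₁)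
    (β : ℝ → ℝ) (hβm : Measurable β)
    (hβlow : ∀ θ ∈ Set.Ioc (0:ℝ) (π / 2), c₁ * θ ^ (-1 - ν) ≤ β θ)
    (ξ : E3) (hξ : ξ ≠ 0) (ε : ℝ) (hε : ε ∈ Set.Ioc (0:ℝ) 1) :
    ENNReal.ofReal ((2 * c₁ / π) * ((π / 2) ^ (2 - ν) / (2 - ν)) *
        min (‖ξ‖ ^ 2) (‖ξ‖ ^ ν))
      ≤ ∫⁻ σ : Metric.sphere (0 : E3) 1,
          ENNReal.ofReal
            ((betaEps β ε (Real.arccos ⟪‖ξ‖⁻¹ • ξ, (σ : E3)⟫) /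
                Real.sin (Real.arccos ⟪‖ξ‖⁻¹ • ξ, (σ : E3)⟫)) *
              min (‖(2⁻¹ : ℝ) • (ξ - ‖ξ‖ • (σ : E3))‖ ^ 2) 1)
          ∂((volume : Measure E3).toSphere) := by
  have hs : 0 < ‖ξ‖ := norm_pos_iff.2 hξ
  have hu : ‖‖ξ‖⁻¹ • ξ‖ = 1 := by
    rw [norm_smul, norm_inv, norm_norm, inv_mul_cancel₀ hs.ne']
  have hπ := pi_pos
  obtain ⟨hε0, hε1⟩ := id hε
  have hν2 : 0 < 2 - ν := by linarith [hν.2]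
  have hβε := measurable_betaEps hβm ε
  set a := min (π / 2) (π / 2 / ‖ξ‖) with ha_def
  have ha : 0 < a := lt_min (by positivity) (by positivity)
  have hsub : Set.Ioc 0 (ε * a / π) ⊆ Set.Ioo 0 π := by
    refine fun θ hθ ↦ ⟨hθ.1, hθ.2.trans_lt ?_⟩
    rw [div_lt_iff₀ hπ]
    have : a ≤ π / 2 := min_le_left _ _
    nlinarith [pi_gt_three]
  have hzonal := lintegral_toSphere_inner hu (F := fun t ↦ ENNReal.ofReal
    (betaEps β ε (arccos t) / sin (arccos t) * min (‖ξ‖ ^ 2 * ((1 - t) / 2)) 1)) (by fun_prop)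
  have hnorm (σ : Metric.sphere (0 : E3) 1) :=
    norm_sq_half_sub_norm_smul hξ (norm_eq_of_mem_sphere σ)
  simp_rw [hnorm]
  rw [hzonal]
  calc ENNReal.ofReal ((2 * c₁ / π) * ((π / 2) ^ (2 - ν) / (2 - ν)) * min (‖ξ‖ ^ 2) (‖ξ‖ ^ ν))
      ≤ ENNReal.ofReal ((2 * π) *
          (c₁ * ‖ξ‖ ^ 2 / (π * ε) * (ε / π) * (a ^ (2 - ν) / (2 - ν)))) := by
        apply ENNReal.ofReal_le_ofReal
        calc _ = 2 * c₁ / π / (2 - ν) * ((π / 2) ^ (2 - ν) * min (‖ξ‖ ^ 2) (‖ξ‖ ^ ν)) := by ring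
          _ ≤ 2 * c₁ / π / (2 - ν) * (‖ξ‖ ^ 2 * a ^ (2 - ν)) := by
            gcongr ?_ * ?_
            exact rpow_mul_min_le_sq_mul_rpow_min hs
          _ = _ := by field_simp
    _ = ENNReal.ofReal (2 * π) * ∫⁻ θ in Set.Ioc 0 (ε * a / π),
          ENNReal.ofReal (c₁ * ‖ξ‖ ^ 2 / (π * ε) * (π * θ / ε) ^ (1 - ν)) := by
        rw [lintegral_rescaled_rpow hν.2 (by positivity) ha hε0, ENNReal.ofReal_mul (by positivity)]
    _ ≤ ENNReal.ofReal (2 * π) * ∫⁻ θ in Set.Ioc 0 (ε * a / π), ENNReal.ofReal (sin θ) *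
          ENNReal.ofReal (betaEps β ε (arccos (cos θ)) / sin (arccos (cos θ)) *
            min (‖ξ‖ ^ 2 * ((1 - cos θ) / 2)) 1) := by
        refine mul_le_mul_right (setLIntegral_mono' measurableSet_Ioc fun θ hθ ↦ ?_) _
        have hθ' := hsub hθ
        have hsin := sin_pos_of_mem_Ioo hθ'
        rw [arccos_cos hθ'.1.le hθ'.2.le, ← ENNReal.ofReal_mul hsin.le, ← mul_assoc,
          mul_div_cancel₀ _ hsin.ne']
        exact ENNReal.ofReal_le_ofReal (rpow_le_betaEps_mul_min hc₁ hβlow hs hε hθ)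
    _ ≤ _ := by
        gcongr
end
end
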